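/- Assume moreover that 𝒞 is a generator for 𝒢(𝒞)^{⊥1}. Let 0→L→M→N→0 be a short exact sequence in 𝒜 which remains exact after applying Hom_𝒜(C,−) for every C∈𝒞. If both M and N admit special 𝒢(𝒞)-precovers, then L admits a special 𝒢(𝒞)-precover. -/

import Mathlib

open CategoryTheory CategoryTheory.Limits CategoryTheory.Abelian ZeroObject

universe w t v u

variable {A : Type u} [Category.{v} A] [Abelian A]

/-- `f`, `g` form a short exact sequence `0 ⟶ X ⟶ Y ⟶ Z ⟶ 0` in `A`. -/
def IsSES {X Y Z : A} (f : X ⟶ Y) (g : Y ⟶ Z) : Prop :=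
  ∃ hw : f ≫ g = 0, (ShortComplex.mk f g hw).ShortExact

/-- The short exact sequence `0 ⟶ X ⟶ Y ⟶ Z ⟶ 0` remains exact after applying
`Hom_A(C, -)` for every `C` in `𝒞`. -/
def HomLeftExact (𝒞 : A → Prop) {X Y Z : A} (f : X ⟶ Y) (g : Y ⟶ Z) : Prop :=
  ∀ ⦃C : A⦄, 𝒞 C →
    Function.Injective (fun h : C ⟶ X => h ≫ f) ∧
    Function.Exact (fun h : C ⟶ X => h ≫ f) (fun h : C ⟶ Y => h ≫ g) ∧
    Function.Surjective (fun h : C ⟶ Y => h ≫ g)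

/-- The short exact sequence `0 ⟶ X ⟶ Y ⟶ Z ⟶ 0` remains exact after applying
`Hom_A(-, C)` for every `C` in `𝒞`. -/
def HomRightExact (𝒞 : A → Prop) {X Y Z : A} (f : X ⟶ Y) (g : Y ⟶ Z) : Prop :=
  ∀ ⦃C : A⦄, 𝒞 C →
    Function.Injective (fun h : Z ⟶ C => g ≫ h) ∧
    Function.Exact (fun h : Z ⟶ C => g ≫ h) (fun h : Y ⟶ C => f ≫ h) ∧
    Function.Surjective (fun h : Y ⟶ C => f ≫ h)

/-- `M` belongs to the Gorenstein subcategory `𝒢(𝒞)`: there is an exact sequence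
`⋯ ⟶ C_1 ⟶ C_0 ⟶ C^0 ⟶ C^1 ⟶ ⋯` with all terms in `𝒞`, which remains exact after
applying `Hom_A(C,-)` and `Hom_A(-,C)` for every `C ∈ 𝒞`, such that
`M ≅ Im(C_0 ⟶ C^0)`. -/
def IsGorenstein (𝒞 : A → Prop) (M : A) : Prop :=
  ∃ (X : ℤ → A) (d : ∀ n : ℤ, X n ⟶ X (n + 1)) (hw : ∀ n, d n ≫ d (n + 1) = 0),
    (∀ n, 𝒞 (X n)) ∧
    (∀ n, (ShortComplex.mk (d n) (d (n + 1)) (hw n)).Exact) ∧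
    (∀ (n : ℤ) ⦃C : A⦄, 𝒞 C →
      Function.Exact (fun h : C ⟶ X n => h ≫ d n) (fun h : C ⟶ X (n + 1) => h ≫ d (n + 1))) ∧
    (∀ (n : ℤ) ⦃C : A⦄, 𝒞 C →
      Function.Exact (fun h : X (n + 1 + 1) ⟶ C => d (n + 1) ≫ h)
        (fun h : X (n + 1) ⟶ C => d n ≫ h)) ∧
    Nonempty (M ≅ Limits.image (d 0))

/-- `𝒞` is a full additive subcategory closed under isomorphisms, encoded as a predicate
closed under isomorphisms, containing a zero object and closed under binary biproducts. -/
def IsAdditiveClosed (𝒞 : A → Prop) : Prop :=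
  (∀ ⦃X Y : A⦄, (X ≅ Y) → 𝒞 X → 𝒞 Y) ∧ 𝒞 (0 : A) ∧ ∀ ⦃X Y : A⦄, 𝒞 X → 𝒞 Y → 𝒞 (X ⊞ Y)

/-- `𝒫(A)` is a generator for `𝒞`: for every `C ∈ 𝒞` there is a short exact sequence
`0 ⟶ C' ⟶ P ⟶ C ⟶ 0` with `P` projective and `C' ∈ 𝒞`. -/
def ProjIsGeneratorFor (𝒞 : A → Prop) : Prop :=
  ∀ ⦃C : A⦄, 𝒞 C → ∃ (C' P : A) (f : C' ⟶ P) (g : P ⟶ C),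
    Projective P ∧ 𝒞 C' ∧ IsSES f g

section Ext

variable [HasExt.{w} A]

/-- `𝒞` is self-orthogonal: `Ext^i(C, C') = 0` for all `i ≥ 1` and `C, C' ∈ 𝒞`. -/
def SelfOrthogonal (𝒞 : A → Prop) : Prop :=
  ∀ ⦃C C' : A⦄, 𝒞 C → 𝒞 C' → ∀ i : ℕ, 1 ≤ i → Subsingleton (Abelian.Ext C C' i)

/-- `M ∈ 𝒢(𝒞)^{⊥1}`, i.e. `Ext^1(G, M) = 0` for every `G ∈ 𝒢(𝒞)`. -/
def RightPerp1 (𝒞 : A → Prop) (M : A) : Prop :=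
  ∀ ⦃G : A⦄, IsGorenstein 𝒞 G → Subsingleton (Abelian.Ext G M 1)

/-- `f : G ⟶ M` is a special `𝒢(𝒞)`-precover of `M`. -/
def IsSpecialPrecover (𝒞 : A → Prop) {G M : A} (f : G ⟶ M) : Prop :=
  IsGorenstein 𝒞 G ∧ Epi f ∧ RightPerp1 𝒞 (kernel f) ∧
    ∀ ⦃G' : A⦄, IsGorenstein 𝒞 G' → Function.Surjective (fun h : G' ⟶ G => h ≫ f)

/-- `M` belongs to the special precovered category `spc(𝒢(𝒞))`. -/
def HasSpecialPrecover (𝒞 : A → Prop) (M : A) : Prop :=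
  ∃ (G : A) (f : G ⟶ M), IsSpecialPrecover 𝒞 f

/-- `𝒞` is a generator for `𝒢(𝒞)^{⊥1}`. -/
def GeneratorForPerp (𝒞 : A → Prop) : Prop :=
  ∀ ⦃T : A⦄, RightPerp1 𝒞 T → ∃ (T' C : A) (f : T' ⟶ C) (g : C ⟶ T),
    𝒞 C ∧ RightPerp1 𝒞 T' ∧ IsSES f g

end Ext

namespace IsSES

variable {X Y Z : A} {f : X ⟶ Y} {g : Y ⟶ Z}

lemma comp_eq_zero (h : IsSES f g) : f ≫ g = 0 := h.1

lemma mono (h : IsSES f g) : Mono f := h.2.mono_f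

lemma epi (h : IsSES f g) : Epi g := h.2.epi_g

lemma exists_lift (h : IsSES f g) {T : A} (x : T ⟶ Y) (hx : x ≫ g = 0) :
    ∃ k : T ⟶ X, k ≫ f = x :=
  have := h.mono
  h.2.exact.lift' x hx

lemma of_exists_lift (hf : Mono f) (hg : Epi g) (w : f ≫ g = 0)
    (H : ∀ (T : A) (x : T ⟶ Y), x ≫ g = 0 → ∃ k : T ⟶ X, k ≫ f = x) : IsSES f g := by
  refine ⟨w, ⟨?_⟩⟩
  rw [ShortComplex.exact_iff_exact_up_to_refinements]
  intro T x hx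
  obtain ⟨k, hk⟩ := H T x hx
  exact ⟨T, 𝟙 T, inferInstance, k, by simp [hk]⟩

lemma kernel_of_epi (g : Y ⟶ Z) [Epi g] : IsSES (kernel.ι g) g :=
  of_exists_lift inferInstance inferInstance (by simp)
    fun _ x hx => ⟨kernel.lift g x hx, by simp⟩

lemma biprod_inl_snd (X Y : A) : IsSES (biprod.inl : X ⟶ X ⊞ Y) (biprod.snd : X ⊞ Y ⟶ Y) :=
  of_exists_lift inferInstance inferInstance (by simp)
    fun _ x hx => ⟨x ≫ biprod.fst, by ext <;> simp [hx]⟩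

lemma biprod_inr_fst (X Y : A) : IsSES (biprod.inr : Y ⟶ X ⊞ Y) (biprod.fst : X ⊞ Y ⟶ X) :=
  of_exists_lift inferInstance inferInstance (by simp)
    fun _ x hx => ⟨x ≫ biprod.snd, by ext <;> simp [hx]⟩

lemma id_zero (X : A) : IsSES (𝟙 X) (0 : X ⟶ 0) :=
  of_exists_lift inferInstance (IsZero.epi (isZero_zero A) _) (by simp)
    fun _ x _ => ⟨x, by simp⟩

lemma zero_id (X : A) : IsSES (0 : 0 ⟶ X) (𝟙 X) :=
  of_exists_lift (IsZero.mono (isZero_zero A) _) inferInstance (by simp)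
    fun _ x hx => ⟨0, by simpa using hx.symm⟩

lemma op (h : IsSES f g) : IsSES g.op f.op :=
  ⟨by rw [← op_comp, h.1, op_zero], h.2.op⟩

lemma unop {X Y Z : Aᵒᵖ} {f : X ⟶ Y} {g : Y ⟶ Z} (h : IsSES f g) : IsSES g.unop f.unop :=
  ⟨by rw [← unop_comp, h.1, unop_zero], h.2.unop⟩

lemma comp_iso (h : IsSES f g) {Z' : A} (e : Z ≅ Z') : IsSES f (g ≫ e.hom) := by
  have := h.epi
  exact of_exists_lift h.mono inferInstance (by rw [← Category.assoc, h.1, zero_comp])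
    fun _ x hx => h.exists_lift x (by simpa [← Category.assoc] using hx)

lemma iso_comp (h : IsSES f g) {X' : A} (e : X' ≅ X) : IsSES (e.hom ≫ f) g := by
  have := h.mono
  refine of_exists_lift inferInstance h.epi (by rw [Category.assoc, h.1, comp_zero])
    fun _ x hx => ?_
  obtain ⟨k, hk⟩ := h.exists_lift x hx
  exact ⟨k ≫ e.inv, by simp [hk]⟩

/-- Given a morphism of short exact sequences whose outer components are epimorphisms, the
middle component is an epimorphism, and the kernels form a short exact sequence. -/
lemma exists_kernels {X₁ X₂ X₃ Y₁ Y₂ Y₃ K₁ K₃ : A}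
    {f : X₁ ⟶ X₂} {g : X₂ ⟶ X₃} {f' : Y₁ ⟶ Y₂} {g' : Y₂ ⟶ Y₃}
    {j₁ : K₁ ⟶ X₁} {q₁ : X₁ ⟶ Y₁} {j₃ : K₃ ⟶ X₃} {q₃ : X₃ ⟶ Y₃} (q₂ : X₂ ⟶ Y₂)
    (h : IsSES f g) (h' : IsSES f' g') (h₁ : IsSES j₁ q₁) (h₃ : IsSES j₃ q₃)
    (w : f ≫ q₂ = q₁ ≫ f') (w' : g ≫ q₃ = q₂ ≫ g') :
    ∃ (K₂ : A) (j₂ : K₂ ⟶ X₂) (a : K₁ ⟶ K₂) (b : K₂ ⟶ K₃), IsSES j₂ q₂ ∧ IsSES a b := by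
  have := h.mono
  have := h.epi
  have := h'.mono
  have := h₁.mono
  have := h₁.epi
  have := h₃.mono
  have := h₃.epi
  have epi_q₂ : Epi q₂ := by
    rw [epi_iff_surjective_up_to_refinements]
    intro T y
    obtain ⟨T₁, π₁, _, x₁, hx₁⟩ := surjective_up_to_refinements_of_epi (g ≫ q₃) (y ≫ g')
    obtain ⟨u, hu⟩ := h'.exists_lift (π₁ ≫ y - x₁ ≫ q₂) (by
      simp only [Preadditive.sub_comp, Category.assoc, hx₁, w', sub_self])
    obtain ⟨T₂, π₂, _, x₂, hx₂⟩ := surjective_up_to_refinements_of_epi q₁ u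
    refine ⟨T₂, π₂ ≫ π₁, inferInstance, π₂ ≫ x₁ + x₂ ≫ f, ?_⟩
    simp only [Preadditive.add_comp, Category.assoc, w]
    rw [← reassoc_of% hx₂, hu]
    simp
  have hK := kernel_of_epi q₂
  have hb : (kernel.ι q₂ ≫ g) ≫ q₃ = 0 := by simp [w']
  obtain ⟨b, hb⟩ := h₃.exists_lift _ hb
  have ha : (j₁ ≫ f) ≫ q₂ = 0 := by
    rw [Category.assoc, w, reassoc_of% h₁.comp_eq_zero, zero_comp]
  obtain ⟨a, ha⟩ := hK.exists_lift _ ha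
  refine ⟨kernel q₂, kernel.ι q₂, a, b, hK, of_exists_lift ?_ ?_ ?_ ?_⟩
  · have : Mono (a ≫ kernel.ι q₂) := by rw [ha]; infer_instance
    exact mono_of_mono a (kernel.ι q₂)
  · rw [epi_iff_surjective_up_to_refinements]
    intro T y
    obtain ⟨T₁, π₁, _, x₁, hx₁⟩ := surjective_up_to_refinements_of_epi g (y ≫ j₃)
    obtain ⟨u, hu⟩ := h'.exists_lift (x₁ ≫ q₂) (by
      rw [Category.assoc, ← w', ← reassoc_of% hx₁, h₃.comp_eq_zero, comp_zero, comp_zero])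
    obtain ⟨T₂, π₂, _, x₂, hx₂⟩ := surjective_up_to_refinements_of_epi q₁ u
    obtain ⟨z, hz⟩ := hK.exists_lift (π₂ ≫ x₁ - x₂ ≫ f) (by
      simp only [Preadditive.sub_comp, Category.assoc, w]
      rw [← reassoc_of% hx₂, hu, sub_self])
    refine ⟨T₂, π₂ ≫ π₁, inferInstance, z, ?_⟩
    rw [← cancel_mono j₃, Category.assoc, Category.assoc, Category.assoc, hb, reassoc_of% hz,
      hx₁]
    simp [h.comp_eq_zero]
  · rw [← cancel_mono j₃, Category.assoc, hb, reassoc_of% ha, h.comp_eq_zero]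
    simp
  · intro T x hx
    obtain ⟨u, hu⟩ := h.exists_lift (x ≫ kernel.ι q₂) (by
      rw [Category.assoc, ← hb, reassoc_of% hx, zero_comp])
    obtain ⟨k, hk⟩ := h₁.exists_lift u (by
      rw [← cancel_mono f', Category.assoc, ← w, reassoc_of% hu]
      simp)
    refine ⟨k, ?_⟩
    rw [← cancel_mono (kernel.ι q₂), Category.assoc, ha, reassoc_of% hk, hu]

/-- Given a morphism of short exact sequences whose outer components are monomorphisms, the
middle component is a monomorphism, and the cokernels form a short exact sequence. -/
lemma exists_cokernels {X₁ X₂ X₃ Y₁ Y₂ Y₃ Q₁ Q₃ : A}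
    {f : X₁ ⟶ X₂} {g : X₂ ⟶ X₃} {f' : Y₁ ⟶ Y₂} {g' : Y₂ ⟶ Y₃}
    {j₁ : X₁ ⟶ Y₁} {q₁ : Y₁ ⟶ Q₁} {j₃ : X₃ ⟶ Y₃} {q₃ : Y₃ ⟶ Q₃} (j₂ : X₂ ⟶ Y₂)
    (h : IsSES f g) (h' : IsSES f' g') (h₁ : IsSES j₁ q₁) (h₃ : IsSES j₃ q₃)
    (w : f ≫ j₂ = j₁ ≫ f') (w' : g ≫ j₃ = j₂ ≫ g') :
    ∃ (Q₂ : A) (q₂ : Y₂ ⟶ Q₂) (a : Q₁ ⟶ Q₂) (b : Q₂ ⟶ Q₃), IsSES j₂ q₂ ∧ IsSES a b := by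
  obtain ⟨K, j, a, b, hj, hab⟩ := exists_kernels j₂.op h'.op h.op h₃.op h₁.op
    (by rw [← op_comp, ← op_comp, w']) (by rw [← op_comp, ← op_comp, w])
  exact ⟨K.unop, j.unop, b.unop, a.unop, hj.unop, hab.unop⟩

/-- If the restriction of `b : E ⟶ M` to a subobject `X` is an epimorphism with kernel `K₁`,
then `b` is an epimorphism whose kernel is an extension of `E / X` by `K₁`. -/
lemma exists_kernel_of_restrict {K₁ X E G M : A} {j₁ : K₁ ⟶ X} {q₁ : X ⟶ M}
    {s : X ⟶ E} {q : E ⟶ G} (h₁ : IsSES j₁ q₁) (h : IsSES s q) (b : E ⟶ M) (w : s ≫ b = q₁) :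
    ∃ (K : A) (j : K ⟶ E) (k : K₁ ⟶ K) (l : K ⟶ G), IsSES j b ∧ IsSES k l :=
  exists_kernels b h (id_zero M) h₁ (id_zero G) (by simp [w]) (by simp)

section Ext

variable [HasExt.{w} A]

lemma exists_lift_of_ext (h : IsSES f g) {G : A} (hG : Subsingleton (Ext G X 1))
    (x : G ⟶ Z) : ∃ k : G ⟶ Y, k ≫ g = x := by
  obtain ⟨y, hy⟩ := Ext.covariant_sequence_exact₃ G h.2 (Ext.mk₀ x) (n₁ := 1) rfl
    (Subsingleton.elim _ _)
  obtain ⟨k, rfl⟩ := Ext.homEquiv₀.symm.surjective y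
  exact ⟨k, Ext.homEquiv₀.symm.injective (by simpa using hy)⟩

lemma exists_desc_of_ext (h : IsSES f g) {C : A} (hC : Subsingleton (Ext Z C 1))
    (x : X ⟶ C) : ∃ k : Y ⟶ C, f ≫ k = x := by
  obtain ⟨y, hy⟩ := Ext.contravariant_sequence_exact₁ h.2 C (Ext.mk₀ x) (n₁ := 1) rfl
    (Subsingleton.elim _ _)
  obtain ⟨k, rfl⟩ := Ext.homEquiv₀.symm.surjective y
  exact ⟨k, Ext.homEquiv₀.symm.injective (by simpa using hy)⟩

lemma ext_left_eq_zero (h : IsSES f g) {G : A} (hY : Subsingleton (Ext G Y 1))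
    (H : ∀ x : G ⟶ Z, ∃ k : G ⟶ Y, k ≫ g = x) : Subsingleton (Ext G X 1) := by
  refine subsingleton_of_forall_eq 0 fun e => ?_
  obtain ⟨z, rfl⟩ := Ext.covariant_sequence_exact₁ G h.2 e (Subsingleton.elim _ _)
    (n₀ := 0) rfl
  obtain ⟨x, rfl⟩ := Ext.homEquiv₀.symm.surjective z
  obtain ⟨k, rfl⟩ := H x
  have := Ext.mk₀_comp_mk₀ k g
  simp only [Ext.homEquiv₀_symm_apply]
  rw [← this, Ext.comp_assoc_of_second_deg_zero]
  have h0 := h.2.comp_extClass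
  dsimp at h0
  rw [h0, Ext.comp_zero]

lemma ext_right_eq_zero (h : IsSES f g) {C : A} (hY : Subsingleton (Ext Y C 1))
    (H : ∀ x : X ⟶ C, ∃ k : Y ⟶ C, f ≫ k = x) : Subsingleton (Ext Z C 1) := by
  refine subsingleton_of_forall_eq 0 fun e => ?_
  obtain ⟨z, rfl⟩ := Ext.contravariant_sequence_exact₃ h.2 C e (Subsingleton.elim _ _)
    (n₀ := 0) rfl
  obtain ⟨x, rfl⟩ := Ext.homEquiv₀.symm.surjective z
  obtain ⟨k, rfl⟩ := H x
  have := Ext.mk₀_comp_mk₀ f k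
  simp only [Ext.homEquiv₀_symm_apply]
  rw [← this]
  exact h.2.extClass_comp_assoc _

lemma ext_covariant_middle (h : IsSES f g) {G : A} (hX : Subsingleton (Ext G X 1))
    (hZ : Subsingleton (Ext G Z 1)) : Subsingleton (Ext G Y 1) := by
  refine subsingleton_of_forall_eq 0 fun e => ?_
  obtain ⟨x, rfl⟩ := Ext.covariant_sequence_exact₂ G h.2 e (Subsingleton.elim _ _)
  rw [Subsingleton.elim x 0, Ext.zero_comp]

lemma ext_contravariant_middle (h : IsSES f g) {C : A} (hX : Subsingleton (Ext X C 1))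
    (hZ : Subsingleton (Ext Z C 1)) : Subsingleton (Ext Y C 1) := by
  refine subsingleton_of_forall_eq 0 fun e => ?_
  obtain ⟨x, rfl⟩ := Ext.contravariant_sequence_exact₂ h.2 C e (Subsingleton.elim _ _)
  rw [Subsingleton.elim x 0, Ext.comp_zero]

end Ext

end IsSES

/-- There is a short exact sequence `0 ⟶ M ⟶ X ⟶ M' ⟶ 0` with `X ∈ 𝒞` which is both
`Hom(𝒞, -)`-exact and `Hom(-, 𝒞)`-exact. -/
def IsSyzygyOf (𝒞 : A → Prop) (M M' : A) : Prop :=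
  ∃ (X : A) (i : M ⟶ X) (p : X ⟶ M'), 𝒞 X ∧ IsSES i p ∧
    (∀ ⦃C : A⦄, 𝒞 C → ∀ h : C ⟶ M', ∃ k, k ≫ p = h) ∧
    (∀ ⦃C : A⦄, 𝒞 C → ∀ h : M ⟶ C, ∃ k, i ≫ k = h)

namespace IsSyzygyOf

variable {𝒞 : A → Prop} {M M' : A}

lemma congr_right (h : IsSyzygyOf 𝒞 M M') {N : A} (e : M' ≅ N) : IsSyzygyOf 𝒞 M N := by
  obtain ⟨X, i, p, hX, hs, hl, hr⟩ := h
  refine ⟨X, i, p ≫ e.hom, hX, hs.comp_iso e, fun C hC h => ?_, hr⟩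
  obtain ⟨k, hk⟩ := hl hC (h ≫ e.inv)
  exact ⟨k, by simp [reassoc_of% hk]⟩

lemma congr_left (h : IsSyzygyOf 𝒞 M M') {N : A} (e : N ≅ M) : IsSyzygyOf 𝒞 N M' := by
  obtain ⟨X, i, p, hX, hs, hl, hr⟩ := h
  refine ⟨X, e.hom ≫ i, p, hX, hs.iso_comp e, hl, fun C hC h => ?_⟩
  obtain ⟨k, hk⟩ := hr hC (e.inv ≫ h)
  exact ⟨k, by simp [hk]⟩

end IsSyzygyOf

lemma IsGorenstein.exists_chain {𝒞 : A → Prop} {M : A} (h : IsGorenstein 𝒞 M) :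
    ∃ Z : ℤ → A, (∀ n, IsSyzygyOf 𝒞 (Z n) (Z (n + 1))) ∧ Nonempty (M ≅ Z 0) := by
  obtain ⟨X, d, hw, hX, hd, hl, hr, e⟩ := h
  refine ⟨fun n => Limits.image (d n), fun n => ⟨X (n + 1), Limits.image.ι (d n),
    factorThruImage (d (n + 1)), hX _, ?_, ?_, ?_⟩, e⟩
  · refine IsSES.of_exists_lift inferInstance inferInstance ?_ fun T x hx => ?_
    · rw [← cancel_epi (factorThruImage (d n)), ← cancel_mono (Limits.image.ι (d (n + 1)))]
      simp [hw]
    · have hS : (ShortComplex.mk (Limits.image.ι (d n)) (d (n + 1)) (by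
          rw [← cancel_epi (factorThruImage (d n))]; simp [hw])).Exact := by
        rw [ShortComplex.exact_iff_exact_up_to_refinements]
        intro T x hx
        obtain ⟨T', π, hπ, y, hy⟩ := (hd n).exact_up_to_refinements x hx
        exact ⟨T', π, hπ, y ≫ factorThruImage (d n), by simpa using hy⟩
      exact hS.lift' x (by
        change x ≫ d (n + 1) = 0
        rw [← Limits.image.fac (d (n + 1)), reassoc_of% hx, zero_comp])
  · intro C hC h
    obtain ⟨k, hk⟩ := (hl (n + 1) hC (h ≫ Limits.image.ι (d (n + 1)))).1 (by
      have : Limits.image.ι (d (n + 1)) ≫ d (n + 1 + 1) = 0 := by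
        rw [← cancel_epi (factorThruImage (d (n + 1)))]; simp [hw]
      simp [this])
    refine ⟨k, ?_⟩
    rw [← cancel_mono (Limits.image.ι (d (n + 1)))]
    simpa using hk
  · obtain ⟨m, rfl⟩ : ∃ m, n = m + 1 := ⟨n - 1, by simp⟩
    intro C hC h
    obtain ⟨k, hk⟩ := (hr m hC (factorThruImage (d (m + 1)) ≫ h)).1 (by
      have : d m ≫ factorThruImage (d (m + 1)) = 0 := by
        rw [← cancel_mono (Limits.image.ι (d (m + 1)))]; simp [hw]
      simp [reassoc_of% this])
    refine ⟨k, ?_⟩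
    rw [← cancel_epi (factorThruImage (d (m + 1)))]
    simpa using hk

lemma IsGorenstein.of_chain {𝒞 : A → Prop} (Z : ℤ → A)
    (hZ : ∀ n, IsSyzygyOf 𝒞 (Z n) (Z (n + 1))) (k : ℤ) : IsGorenstein 𝒞 (Z k) := by
  suffices ∀ Z : ℤ → A, (∀ n, IsSyzygyOf 𝒞 (Z n) (Z (n + 1))) → IsGorenstein 𝒞 (Z (0 + 1)) by
    have h := this (fun n => Z (n + (k - 1))) fun n => by
      have := hZ (n + (k - 1))
      rwa [add_right_comm] at this
    simpa using h
  intro Z hZ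
  choose X i p hX hs hl hr using hZ
  have := fun n => (hs n).mono
  have := fun n => (hs n).epi
  have := strongEpi_of_epi (p 0)
  refine ⟨X, fun n => p n ≫ i (n + 1), fun n => ?_, hX, fun n => ?_, fun n C hC y => ?_,
    fun n C hC y => ?_, ⟨image.isoStrongEpiMono (p 0) (i (0 + 1)) rfl⟩⟩
  · rw [Category.assoc, reassoc_of% (hs (n + 1)).comp_eq_zero, zero_comp, comp_zero]
  · rw [ShortComplex.exact_iff_exact_up_to_refinements]
    intro T x hx
    dsimp at x hx
    obtain ⟨u, rfl⟩ := (hs (n + 1)).exists_lift x (by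
      rw [← cancel_mono (i (n + 1 + 1))]; simpa using hx)
    obtain ⟨T', π, hπ, y, hy⟩ := surjective_up_to_refinements_of_epi (p n) u
    exact ⟨T', π, hπ, y, by simp [reassoc_of% hy]⟩
  · constructor
    · intro hy
      obtain ⟨u, rfl⟩ := (hs (n + 1)).exists_lift y (by
        rw [← cancel_mono (i (n + 1 + 1))]; simpa using hy)
      obtain ⟨v, rfl⟩ := hl n hC u
      exact ⟨v, by simp⟩
    · rintro ⟨v, rfl⟩
      simp [reassoc_of% (hs (n + 1)).comp_eq_zero]
  · constructor
    · intro hy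
      obtain ⟨u, hu⟩ : ∃ u, p (n + 1) ≫ u = y :=
        ⟨(hs (n + 1)).2.exact.desc y (by
          rw [← cancel_epi (p n)]; simpa using hy), (hs (n + 1)).2.exact.g_desc y _⟩
      obtain ⟨v, rfl⟩ := hr (n + 1 + 1) hC u
      exact ⟨v, by simpa using hu⟩
    · rintro ⟨v, rfl⟩
      simp [reassoc_of% (hs (n + 1)).comp_eq_zero]

/-- Coinduction principle for the Gorenstein subcategory. -/
lemma IsGorenstein.coinduction {𝒞 : A → Prop} (P : A → Prop)
    (hl : ∀ M, P M → ∃ M', P M' ∧ IsSyzygyOf 𝒞 M' M)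
    (hr : ∀ M, P M → ∃ M', P M' ∧ IsSyzygyOf 𝒞 M M') {M : A} (hM : P M) :
    IsGorenstein 𝒞 M := by
  choose l hlP hl using fun M : {M // P M} => hl M.1 M.2
  choose r hrP hr using fun M : {M // P M} => hr M.1 M.2
  let L : ℕ → {M // P M} := fun n => (fun M => ⟨l M, hlP M⟩)^[n] ⟨M, hM⟩
  let R : ℕ → {M // P M} := fun n => (fun M => ⟨r M, hrP M⟩)^[n] ⟨M, hM⟩
  have hL : ∀ n, IsSyzygyOf 𝒞 (L (n + 1)).1 (L n).1 := fun n => by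
    simp only [L, Function.iterate_succ_apply']
    exact hl _
  have hR : ∀ n, IsSyzygyOf 𝒞 (R n).1 (R (n + 1)).1 := fun n => by
    simp only [R, Function.iterate_succ_apply']
    exact hr _
  let Z : ℤ → A := fun k => match k with
    | Int.ofNat n => (R n).1
    | Int.negSucc n => (L (n + 1)).1
  refine IsGorenstein.of_chain Z (fun k => ?_) 0
  match k with
  | Int.ofNat n => exact hR n
  | Int.negSucc 0 => exact hL 0
  | Int.negSucc (n + 1) => exact hL (n + 1)

lemma IsGorenstein.exists_left {𝒞 : A → Prop} {M : A} (h : IsGorenstein 𝒞 M) :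
    ∃ M', IsGorenstein 𝒞 M' ∧ IsSyzygyOf 𝒞 M' M := by
  obtain ⟨Z, hZ, ⟨e⟩⟩ := h.exists_chain
  exact ⟨Z (-1), .of_chain Z hZ _, (hZ (-1)).congr_right e.symm⟩

lemma IsGorenstein.exists_right {𝒞 : A → Prop} {M : A} (h : IsGorenstein 𝒞 M) :
    ∃ M', IsGorenstein 𝒞 M' ∧ IsSyzygyOf 𝒞 M M' := by
  obtain ⟨Z, hZ, ⟨e⟩⟩ := h.exists_chain
  exact ⟨Z (0 + 1), .of_chain Z hZ _, (hZ 0).congr_left e⟩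

lemma IsGorenstein.of_mem {𝒞 : A → Prop} (hadd : IsAdditiveClosed 𝒞) {M : A} (hM : 𝒞 M) :
    IsGorenstein 𝒞 M :=
  IsGorenstein.coinduction 𝒞
    (fun M hM => ⟨0, hadd.2.1, M, 0, 𝟙 M, hM, .zero_id M, fun _ _ h => ⟨h, by simp⟩,
      fun _ _ _ => ⟨0, (isZero_zero A).eq_of_src _ _⟩⟩)
    (fun M hM => ⟨0, hadd.2.1, M, 𝟙 M, 0, hM, .id_zero M,
      fun _ _ _ => ⟨0, (isZero_zero A).eq_of_tgt _ _⟩, fun _ _ h => ⟨h, by simp⟩⟩) hM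

section Ext

variable [HasExt.{w} A] {𝒞 : A → Prop}

lemma IsGorenstein.ext_left (hso : SelfOrthogonal 𝒞) {G C : A} (hG : IsGorenstein 𝒞 G)
    (hC : 𝒞 C) : Subsingleton (Ext G C 1) := by
  obtain ⟨_, _, X, i, p, hX, hs, -, hr⟩ := hG.exists_left
  exact hs.ext_right_eq_zero (hso hX hC 1 le_rfl) (hr hC)

lemma IsGorenstein.ext_right (hso : SelfOrthogonal 𝒞) {G C : A} (hG : IsGorenstein 𝒞 G)
    (hC : 𝒞 C) : Subsingleton (Ext C G 1) := by
  obtain ⟨_, _, X, i, p, hX, hs, hl, -⟩ := hG.exists_right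
  exact hs.ext_left_eq_zero (hso hC hX 1 le_rfl) (hl hC)

/-- The Gorenstein subcategory is closed under extensions. -/
lemma IsGorenstein.of_isSES (hadd : IsAdditiveClosed 𝒞) (hso : SelfOrthogonal 𝒞)
    {G₁ H G₂ : A} {i : G₁ ⟶ H} {p : H ⟶ G₂} (hs : IsSES i p)
    (h₁ : IsGorenstein 𝒞 G₁) (h₂ : IsGorenstein 𝒞 G₂) : IsGorenstein 𝒞 H := by
  let P : A → Prop := fun H => ∃ (G₁ G₂ : A) (i : G₁ ⟶ H) (p : H ⟶ G₂),
    IsSES i p ∧ IsGorenstein 𝒞 G₁ ∧ IsGorenstein 𝒞 G₂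
  have syzygy {M X M' : A} {i : M ⟶ X} {p : X ⟶ M'} (hX : 𝒞 X) (h : IsSES i p)
      (hM : P M) (hM' : P M') : IsSyzygyOf 𝒞 M M' := by
    obtain ⟨_, _, _, _, hs, h₁, h₂⟩ := hM
    obtain ⟨_, _, _, _, hs', h₁', h₂'⟩ := hM'
    exact ⟨X, i, p, hX, h,
      fun C hC => h.exists_lift_of_ext
        (hs.ext_covariant_middle (h₁.ext_right hso hC) (h₂.ext_right hso hC)),
      fun C hC => h.exists_desc_of_ext
        (hs'.ext_contravariant_middle (h₁'.ext_left hso hC) (h₂'.ext_left hso hC))⟩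
  refine IsGorenstein.coinduction P (fun H hH => ?_) (fun H hH => ?_) ⟨_, _, _, _, hs, h₁, h₂⟩
  · obtain ⟨G₁, G₂, i, p, hs, h₁, h₂⟩ := id hH
    obtain ⟨K₁, hK₁, C₁, j₁, q₁, hC₁, hs₁, -, -⟩ := h₁.exists_left
    obtain ⟨K₂, hK₂, C₂, j₂, q₂, hC₂, hs₂, -, -⟩ := h₂.exists_left
    obtain ⟨k, hk⟩ := hs.exists_lift_of_ext (h₁.ext_right hso hC₂) q₂
    obtain ⟨K, j, a, b, hj, hab⟩ := IsSES.exists_kernels (biprod.desc (q₁ ≫ i) k)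
      (.biprod_inl_snd C₁ C₂) hs hs₁ hs₂ (by simp) (by ext <;> simp [hs.comp_eq_zero, hk])
    have hK : P K := ⟨_, _, _, _, hab, hK₁, hK₂⟩
    exact ⟨K, hK, syzygy (hadd.2.2 hC₁ hC₂) hj hK hH⟩
  · obtain ⟨G₁, G₂, i, p, hs, h₁, h₂⟩ := id hH
    obtain ⟨K₁, hK₁, C₁, j₁, q₁, hC₁, hs₁, -, -⟩ := h₁.exists_right
    obtain ⟨K₂, hK₂, C₂, j₂, q₂, hC₂, hs₂, -, -⟩ := h₂.exists_right
    obtain ⟨k, hk⟩ := hs.exists_desc_of_ext (h₂.ext_left hso hC₁) j₁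
    obtain ⟨K, q, a, b, hq, hab⟩ := IsSES.exists_cokernels (biprod.lift k (p ≫ j₂))
      hs (.biprod_inl_snd C₁ C₂) hs₁ hs₂
      (by ext <;> simp [reassoc_of% hs.comp_eq_zero, hk]) (by simp)
    have hK : P K := ⟨_, _, _, _, hab, hK₁, hK₂⟩
    exact ⟨K, hK, syzygy (hadd.2.2 hC₁ hC₂) hq hH hK⟩

lemma IsSpecialPrecover.of_rightPerp1 {G M : A} {f : G ⟶ M} (hG : IsGorenstein 𝒞 G)
    (hf : Epi f) (hK : RightPerp1 𝒞 (kernel f)) : IsSpecialPrecover 𝒞 f :=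
  ⟨hG, hf, hK, fun _ hG' x => (IsSES.kernel_of_epi f).exists_lift_of_ext (hK hG') x⟩

end Ext

/-- assume `𝒞` is a generator for `𝒢(𝒞)^{⊥1}`. Given a `Hom(𝒞,-)`-exact
short exact sequence `0 ⟶ L ⟶ M ⟶ N ⟶ 0`, if `M` and `N` admit special
`𝒢(𝒞)`-precovers then so does `L`. -/
theorem stmt_16 [HasExt.{w} A] (𝒞 : A → Prop) (hadd : IsAdditiveClosed 𝒞)
    (hso : SelfOrthogonal 𝒞) (hgen : ProjIsGeneratorFor 𝒞)
    (hCgen : GeneratorForPerp 𝒞)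
    {L M N : A} (f : L ⟶ M) (g : M ⟶ N) (hses : IsSES f g)
    (hlex : HomLeftExact 𝒞 f g)
    (hM : HasSpecialPrecover 𝒞 M) (hN : HasSpecialPrecover 𝒞 N) :
    HasSpecialPrecover 𝒞 L := by
  obtain ⟨GM, cM, hGM, _, hKM, -⟩ := hM
  obtain ⟨GN, cN, hGN, _, hKN, hcN⟩ := hN
  have hcNs := IsSES.kernel_of_epi cN
  obtain ⟨φ, hφ⟩ := hcN hGM (cM ≫ g)
  obtain ⟨G₀, hG₀, C₀, j₀, γ₀, hC₀, hs₀, -, -⟩ := hGN.exists_left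
  obtain ⟨μ₀, hμ₀⟩ := (hlex hC₀).2.2 (γ₀ ≫ cN)
  obtain ⟨T₁, C₁, j₁, c₁, hC₁, hT₁, hs₁⟩ := hCgen hKN
  dsimp only at hφ hμ₀
  have := hses.mono
  have := hs₁.epi
  let γ : C₁ ⊞ C₀ ⟶ GN := biprod.desc (c₁ ≫ kernel.ι cN) γ₀
  let a : GM ⊞ (C₁ ⊞ C₀) ⟶ GN := biprod.desc φ γ
  let b : GM ⊞ (C₁ ⊞ C₀) ⟶ M := biprod.desc cM (biprod.desc 0 μ₀)
  have hab : a ≫ cN = b ≫ g := by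
    ext <;> simp [a, b, γ, hφ, hμ₀]
  -- the kernel of `a` is Gorenstein
  obtain ⟨D, jD, _, _, hD, hD'⟩ := IsSES.exists_kernel_of_restrict hs₀
    (IsSES.biprod_inr_fst C₁ C₀) γ (by simp [γ])
  obtain ⟨H, jH, _, _, hH, hH'⟩ := IsSES.exists_kernel_of_restrict hD
    (IsSES.biprod_inr_fst GM (C₁ ⊞ C₀)) a (by simp [a])
  have hHG : IsGorenstein 𝒞 H :=
    .of_isSES hadd hso hH' (.of_isSES hadd hso hD' hG₀ (.of_mem hadd hC₁)) hGM
  -- the kernel of `b` belongs to the orthogonal class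
  obtain ⟨K, jK, _, _, hK, hK'⟩ := IsSES.exists_kernel_of_restrict (IsSES.kernel_of_epi cM)
    (IsSES.biprod_inl_snd GM (C₁ ⊞ C₀)) b (by simp [b])
  have hKP : RightPerp1 𝒞 K := fun G hG =>
    hK'.ext_covariant_middle (hKM hG) (hG.ext_left hso (hadd.2.2 hC₁ hC₀))
  have := hK.mono
  have := hK.epi
  have := hH.mono
  obtain ⟨l, hl⟩ := hses.exists_lift (jH ≫ b) (by
    rw [Category.assoc, ← hab, reassoc_of% hH.comp_eq_zero, zero_comp])
  obtain ⟨r, hr⟩ := hcNs.exists_lift (jK ≫ a) (by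
    rw [Category.assoc, hab, reassoc_of% hK.comp_eq_zero, zero_comp])
  let ι₁ : C₁ ⟶ GM ⊞ (C₁ ⊞ C₀) := biprod.inl ≫ biprod.inr
  have hι₁a : ι₁ ≫ a = c₁ ≫ kernel.ι cN := by simp [ι₁, a, γ]
  have hι₁b : ι₁ ≫ b = 0 := by simp [ι₁, b]
  obtain ⟨s, hs⟩ := hK.exists_lift ι₁ hι₁b
  have hsr : s ≫ r = c₁ := by
    rw [← cancel_mono (kernel.ι cN), Category.assoc, hr, reassoc_of% hs, hι₁a]
  have epi_l : Epi l := by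
    rw [epi_iff_surjective_up_to_refinements]
    intro T x
    obtain ⟨T', π, _, z, hz⟩ := surjective_up_to_refinements_of_epi b (x ≫ f)
    obtain ⟨u, hu⟩ := hcNs.exists_lift (z ≫ a) (by
      rw [Category.assoc, hab, ← reassoc_of% hz, hses.comp_eq_zero, comp_zero, comp_zero])
    obtain ⟨T'', π', _, v, hv⟩ := surjective_up_to_refinements_of_epi c₁ u
    obtain ⟨y, hy⟩ := hH.exists_lift (π' ≫ z - v ≫ ι₁) (by
      rw [Preadditive.sub_comp, Category.assoc, Category.assoc, hι₁a, ← hu, reassoc_of% hv,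
        sub_self])
    refine ⟨T'', π' ≫ π, inferInstance, y, ?_⟩
    rw [← cancel_mono f, Category.assoc, Category.assoc, Category.assoc, hl, reassoc_of% hy, hz]
    simp [hι₁b]
  have epi_r : Epi r := by
    have : Epi (s ≫ r) := by rw [hsr]; infer_instance
    exact epi_of_epi s r
  obtain ⟨t, ht⟩ := hK.exists_lift (kernel.ι l ≫ jH) (by
    rw [Category.assoc, ← hl, kernel.condition_assoc, zero_comp])
  have hT : IsSES t r := by
    refine .of_exists_lift ?_ epi_r ?_ fun T x hx => ?_
    · have : Mono (t ≫ jK) := by rw [ht]; infer_instance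
      exact mono_of_mono t jK
    · rw [← cancel_mono (kernel.ι cN), Category.assoc, hr, reassoc_of% ht, hH.comp_eq_zero]
      simp
    · obtain ⟨y, hy⟩ := hH.exists_lift (x ≫ jK) (by
        rw [Category.assoc, ← hr, reassoc_of% hx, zero_comp])
      refine ⟨kernel.lift l y ?_, ?_⟩
      · rw [← cancel_mono f, Category.assoc, hl, reassoc_of% hy, hK.comp_eq_zero]
        simp
      · rw [← cancel_mono jK, Category.assoc, ht, kernel.lift_ι_assoc, hy]
  refine ⟨H, l, .of_rightPerp1 hHG epi_l fun G hG => hT.ext_left_eq_zero (hKP hG) fun x => ?_⟩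
  obtain ⟨k, rfl⟩ := hs₁.exists_lift_of_ext (hT₁ hG) x
  exact ⟨k ≫ s, by rw [Category.assoc, hsr]⟩
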